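/- Let X₁, …, Xₙ be bounded random variables taking values in {0, 1} and ε₁, …, εₙ bounded random variables on a common probability space, let δ₊ > δ₋ be real numbers, and define μᵢ = δ₊ · Xᵢ + δ₋ · (1 − Xᵢ) + εᵢ for each i, Perf = Σ_{i=1}^n μᵢ, CoSP-0 = Σ_{i=1}^n Xᵢ, and CoSP-1 = 2 · Σ_{i=1}^n Xᵢ − n. Assume Cov(μᵢ, Xⱼ) = 0 whenever i ≠ j, Cov(εᵢ, Xᵢ) = 0 for every i, and Var(X_{i₀}) > 0 for at least one index i₀. Then Cov(Perf, CoSP-0) = (δ₊ − δ₋) · Σ_{i=1}^n Var(Xᵢ) > 0 and Cov(Perf, CoSP-1) = 2 · (δ₊ − δ₋) · Σ_{i=1}^n Var(Xᵢ) > 0; in particular both CoSP-0 and CoSP-1 are positively correlated with Perf. -/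

import Mathlib

open MeasureTheory

/-- The covariance `Cov(Y, Z) = E[YZ] − E[Y]E[Z]` of two real random variables. -/
noncomputable def cov {Ω : Type*} [MeasurableSpace Ω] (P : Measure Ω)
    (Y Z : Ω → ℝ) : ℝ :=
  (∫ ω, Y ω * Z ω ∂P) - (∫ ω, Y ω ∂P) * (∫ ω, Z ω ∂P)

open ProbabilityTheory

lemma cov_eq_covariance {Ω : Type*} [MeasurableSpace Ω] {P : Measure Ω}
    [IsProbabilityMeasure P] {Y Z : Ω → ℝ} (hY : MemLp Y 2 P) (hZ : MemLp Z 2 P) :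
    cov P Y Z = covariance Y Z P :=
  (covariance_eq_sub hY hZ).symm

lemma cov_self_nonneg {Ω : Type*} [MeasurableSpace Ω] {P : Measure Ω}
    [IsProbabilityMeasure P] {Y : Ω → ℝ} (hY : MemLp Y 2 P) : 0 ≤ cov P Y Y := by
  rw [cov_eq_covariance hY hY, covariance_self hY.aemeasurable]
  exact variance_nonneg Y P

/-- With `μᵢ = δ₊·Xᵢ + δ₋·(1−Xᵢ) + εᵢ`, `Perf = Σᵢ μᵢ`, `CoSP-0 = Σᵢ Xᵢ`,
`CoSP-1 = 2·Σᵢ Xᵢ − n`, `δ₊ > δ₋`, `Cov(μᵢ, Xⱼ) = 0` for `i ≠ j`,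
`Cov(εᵢ, Xᵢ) = 0` for all `i`, and `Var(X_{i₀}) > 0` for some `i₀`, one has
`Cov(Perf, CoSP-0) = (δ₊ − δ₋) · Σᵢ Var(Xᵢ) > 0` and
`Cov(Perf, CoSP-1) = 2 · (δ₊ − δ₋) · Σᵢ Var(Xᵢ) > 0`. -/
theorem cov_perf_cosp0_cosp1_pos {Ω : Type*} [MeasurableSpace Ω] (P : Measure Ω)
    [IsProbabilityMeasure P] (n : ℕ) (X ε : Fin n → Ω → ℝ) (δp δm : ℝ)
    (hδ : δm < δp)
    (hXmeas : ∀ i, Measurable (X i)) (hεmeas : ∀ i, Measurable (ε i))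
    (hX01 : ∀ i ω, X i ω = 0 ∨ X i ω = 1)
    (hεbdd : ∀ i, ∃ C : ℝ, ∀ ω, |ε i ω| ≤ C)
    (μ : Fin n → Ω → ℝ)
    (hμ : ∀ i ω, μ i ω = δp * X i ω + δm * (1 - X i ω) + ε i ω)
    (hcross : ∀ i j, i ≠ j → cov P (μ i) (X j) = 0)
    (hres : ∀ i, cov P (ε i) (X i) = 0)
    (hvar : ∃ i₀, 0 < cov P (X i₀) (X i₀)) :
    (cov P (fun ω => ∑ i, μ i ω) (fun ω => ∑ i, X i ω)
        = (δp - δm) * ∑ i, cov P (X i) (X i) ∧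
      0 < cov P (fun ω => ∑ i, μ i ω) (fun ω => ∑ i, X i ω)) ∧
    (cov P (fun ω => ∑ i, μ i ω) (fun ω => 2 * ∑ i, X i ω - n)
        = 2 * (δp - δm) * ∑ i, cov P (X i) (X i) ∧
      0 < cov P (fun ω => ∑ i, μ i ω) (fun ω => 2 * ∑ i, X i ω - n)) := by
  have hX2 : ∀ i, MemLp (X i) 2 P := fun i =>
    MemLp.of_bound (hXmeas i).aestronglyMeasurable 1 <| .of_forall fun ω => by
      rcases hX01 i ω with h | h <;> simp [h]
  have hε2 : ∀ i, MemLp (ε i) 2 P := fun i => by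
    obtain ⟨C, hC⟩ := hεbdd i
    exact MemLp.of_bound (hεmeas i).aestronglyMeasurable C (.of_forall hC)
  have hlin2 : ∀ i, MemLp (fun ω => (δp - δm) * X i ω + ε i ω) 2 P := fun i =>
    ((hX2 i).const_mul _).add (hε2 i)
  have hμ_eq : ∀ i, μ i = fun ω => ((δp - δm) * X i ω + ε i ω) + δm := fun i => by
    funext ω
    rw [hμ]
    ring
  have hμ2 : ∀ i, MemLp (μ i) 2 P := fun i => by
    rw [hμ_eq i]
    exact (hlin2 i).add (memLp_const δm)
  have hPerf2 : MemLp (fun ω => ∑ i, μ i ω) 2 P := memLp_finsetSum _ fun i _ => hμ2 i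
  have hSum2 : MemLp (fun ω => ∑ i, X i ω) 2 P := memLp_finsetSum _ fun i _ => hX2 i
  have hdiag : ∀ i, cov P (μ i) (X i) = (δp - δm) * cov P (X i) (X i) := fun i => by
    have h := hres i
    rw [cov_eq_covariance (hε2 i) (hX2 i)] at h
    rw [cov_eq_covariance (hμ2 i) (hX2 i), cov_eq_covariance (hX2 i) (hX2 i), hμ_eq i,
      covariance_add_const_left ((hlin2 i).integrable one_le_two)]
    change covariance ((fun ω => (δp - δm) * X i ω) + ε i) (X i) P = _
    rw [covariance_add_left ((hX2 i).const_mul _) (hε2 i) (hX2 i), covariance_const_mul_left, h,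
      add_zero]
  have hcov0 : cov P (fun ω => ∑ i, μ i ω) (fun ω => ∑ i, X i ω)
      = (δp - δm) * ∑ i, cov P (X i) (X i) := by
    rw [cov_eq_covariance hPerf2 hSum2, covariance_fun_sum_fun_sum hμ2 hX2, Finset.mul_sum]
    refine Finset.sum_congr rfl fun i _ => ?_
    rw [Finset.sum_eq_single_of_mem i (Finset.mem_univ i), ← cov_eq_covariance (hμ2 i) (hX2 i),
      hdiag i]
    intro j _ hji
    rw [← cov_eq_covariance (hμ2 i) (hX2 j), hcross i j hji.symm]
  have hcov1 : cov P (fun ω => ∑ i, μ i ω) (fun ω => 2 * ∑ i, X i ω - n)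
      = 2 * cov P (fun ω => ∑ i, μ i ω) (fun ω => ∑ i, X i ω) := by
    have hCoSP2 : MemLp (fun ω => 2 * ∑ i, X i ω - n) 2 P :=
      (hSum2.const_mul 2).sub (memLp_const (n : ℝ))
    rw [cov_eq_covariance hPerf2 hCoSP2,
      cov_eq_covariance hPerf2 hSum2,
      covariance_sub_const_right ((hSum2.const_mul 2).integrable one_le_two),
      covariance_const_mul_right]
  have hvar_sum : 0 < ∑ i, cov P (X i) (X i) := by
    obtain ⟨i₀, hi₀⟩ := hvar
    exact Finset.sum_pos' (fun i _ => cov_self_nonneg (hX2 i)) ⟨i₀, Finset.mem_univ i₀, hi₀⟩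
  have hpos := mul_pos (sub_pos.mpr hδ) hvar_sum
  rw [hcov1, hcov0]
  exact ⟨⟨rfl, hpos⟩, (mul_assoc _ _ _).symm, mul_pos two_pos hpos⟩
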